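/- Let m ≥ 2, n ≥ 1, let ρ, σ be density matrices on ℂ^d, and let ϱ = ρ^{⊗m} ⊗ σ^{⊗n} (indexed by pairs (x,y), x : Fin m → Fin d, y : Fin n → Fin d, with entry ∏_s ρ[x s, x' s]·∏_t σ[y t, y' t]). Let O_{ρρ} be the average over all transpositions τ of Fin m of the operator permuting the corresponding two ρ-factors (acting as identity on the σ-factors), and let O_{ρσ} = (1/(mn))·Σ_{s ∈ Fin m, t ∈ Fin n} X_{s,t}, where X_{s,t} swaps the s-th ρ-factor with the t-th σ-factor. Then tr(ϱ·O_{ρρ}·O_{ρσ}) − tr(ϱ·O_{ρρ})·tr(ϱ·O_{ρσ}) = (2/m)·(tr(ρ²σ) − tr(ρ²)·tr(ρσ)). -/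

import Mathlib

open Matrix
open scoped ComplexOrder

/-- The state `ρ^{⊗m} ⊗ σ^{⊗n}` as a matrix indexed by pairs
`(x, y)` with `x : Fin m → Fin d`, `y : Fin n → Fin d`. -/
noncomputable def pairState (m n d : ℕ) (ρ σ : Matrix (Fin d) (Fin d) ℂ) :
    Matrix ((Fin m → Fin d) × (Fin n → Fin d)) ((Fin m → Fin d) × (Fin n → Fin d)) ℂ :=
  Matrix.of fun p q => (∏ s, ρ (p.1 s) (q.1 s)) * ∏ t, σ (p.2 t) (q.2 t)

/-- The operator `X_{s,t}` swapping the `s`-th ρ-factor with the `t`-th σ-factor. -/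
noncomputable def swapOp (m n d : ℕ) (s : Fin m) (t : Fin n) :
    Matrix ((Fin m → Fin d) × (Fin n → Fin d)) ((Fin m → Fin d) × (Fin n → Fin d)) ℂ :=
  Matrix.of fun p q =>
    if (∀ i, i ≠ s → q.1 i = p.1 i) ∧ (∀ j, j ≠ t → q.2 j = p.2 j) ∧
        q.1 s = p.2 t ∧ q.2 t = p.1 s
    then 1 else 0

/-- The observable `O_{(ρσ)} = (1/(mn)) Σ_{s,t} X_{s,t}`. -/
noncomputable def Oρσ (m n d : ℕ) :
    Matrix ((Fin m → Fin d) × (Fin n → Fin d)) ((Fin m → Fin d) × (Fin n → Fin d)) ℂ :=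
  (1 / ((m : ℂ) * (n : ℂ))) • ∑ s : Fin m, ∑ t : Fin n, swapOp m n d s t

/-- The operator permuting the ρ-factors according to `π` and fixing the σ-factors. -/
noncomputable def permOpLeft (m n d : ℕ) (π : Equiv.Perm (Fin m)) :
    Matrix ((Fin m → Fin d) × (Fin n → Fin d)) ((Fin m → Fin d) × (Fin n → Fin d)) ℂ :=
  Matrix.of fun p q => if q.1 = p.1 ∘ ⇑π ∧ q.2 = p.2 then 1 else 0

/-- The set of transpositions in the symmetric group on `Fin m`. -/
noncomputable def transpositions (m : ℕ) : Finset (Equiv.Perm (Fin m)) :=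
  @Finset.filter _ (fun τ : Equiv.Perm (Fin m) => τ.IsSwap) (Classical.decPred _)
    Finset.univ

/-- The observable `O_{(ρρ)}`: the average over transpositions `τ` of `Fin m` of
the operator permuting the corresponding two ρ-factors. -/
noncomputable def Oρρ (m n d : ℕ) :
    Matrix ((Fin m → Fin d) × (Fin n → Fin d)) ((Fin m → Fin d) × (Fin n → Fin d)) ℂ :=
  ((transpositions m).card : ℂ)⁻¹ • ∑ τ ∈ transpositions m, permOpLeft m n d τ

theorem trace_submatrix_equiv {ι κ R : Type*} [Fintype ι] [Fintype κ] [AddCommMonoid R]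
    (e : ι ≃ κ) (M : Matrix κ κ R) : (M.submatrix e e).trace = M.trace :=
  e.sum_comp fun i => M i i

section PermutationTraces

variable {ι κ : Type*} [Fintype ι] [DecidableEq ι] [Fintype κ] [DecidableEq κ]

/-- The tensor product `⨂ i, A i`. -/
def tensorMatrix (A : ι → Matrix κ κ ℂ) : Matrix (ι → κ) (ι → κ) ℂ :=
  Matrix.of fun p q => ∏ i, A i (p i) (q i)

/-- The operator permuting tensor factors according to `π`. -/
def factorPerm (κ : Type*) [DecidableEq κ] (π : Equiv.Perm ι) : Matrix (ι → κ) (ι → κ) ℂ :=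
  Matrix.of fun p q => if q = p ∘ π then 1 else 0

theorem factorPerm_mul (π τ : Equiv.Perm ι) :
    factorPerm κ π * factorPerm κ τ = factorPerm κ (π * τ) := by
  ext p q
  rw [Matrix.mul_apply, Finset.sum_eq_single (p ∘ π)]
  · simp only [factorPerm, Matrix.of_apply, if_true, one_mul, Equiv.Perm.coe_mul,
      Function.comp_assoc]
    congr
  · intro j _ hj
    simp [factorPerm, hj]
  · simp

theorem trace_tensorMatrix_mul_factorPerm (A : ι → Matrix κ κ ℂ) (π : Equiv.Perm ι) :
    (tensorMatrix A * factorPerm κ π).trace = ∑ z : ι → κ, ∏ i, A i (z (π i)) (z i) := by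
  simp only [Matrix.trace, Matrix.diag_apply, Matrix.mul_apply, tensorMatrix, factorPerm,
    Matrix.of_apply]
  rw [← Equiv.sum_comp (π.symm.arrowCongr (Equiv.refl κ))]
  refine Finset.sum_congr rfl fun z _ => ?_
  rw [Finset.sum_eq_single z]
  · rw [if_pos (by ext; simp [Equiv.arrowCongr]), mul_one]
    simp [Equiv.arrowCongr]
  · intro q _ hq
    rw [if_neg, mul_zero]
    exact fun h => hq (funext fun i => by simpa [Equiv.arrowCongr] using
      (congrFun h (π.symm i)).symm)
  · simp

theorem trace_tensorMatrix_mul_factorPerm_one (A : ι → Matrix κ κ ℂ) :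
    (tensorMatrix A * factorPerm κ 1).trace = ∏ i, (A i).trace := by
  rw [trace_tensorMatrix_mul_factorPerm]
  simp only [Equiv.Perm.one_apply, Matrix.trace, Matrix.diag_apply]
  exact (Fintype.prod_sum fun i k => A i k k).symm

/-- If `π i = j`, summing over the index of factor `j` merges it into factor `i`. -/
theorem trace_tensorMatrix_mul_factorPerm_merge (A : ι → Matrix κ κ ℂ) (π : Equiv.Perm ι)
    {i j : ι} (hij : i ≠ j) (hπ : π i = j) (hA : (A j).trace = 1) :
    (tensorMatrix A * factorPerm κ π).trace =
      (tensorMatrix (Function.update A i (A j * A i)) *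
        factorPerm κ (π * Equiv.swap i j)).trace := by
  simp only [trace_tensorMatrix_mul_factorPerm]
  rw [← Equiv.sum_comp (Equiv.funSplitAt j κ).symm, ← Equiv.sum_comp (Equiv.funSplitAt j κ).symm,
    Fintype.sum_prod_type_right, Fintype.sum_prod_type_right]
  refine Finset.sum_congr rfl fun w _ => ?_
  rcases isEmpty_or_nonempty κ with hκ | ⟨⟨v₀⟩⟩
  · simp
  have hj : π j ≠ j := fun h => hij (π.injective (hπ.trans h.symm))
  have hji : j ∈ Finset.univ.erase i := by simp [hij.symm]
  have hsplit (f : ι → ℂ) :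
      ∏ k, f k = f i * f j * ∏ k ∈ (Finset.univ.erase i).erase j, f k := by
    rw [← Finset.mul_prod_erase _ _ (Finset.mem_univ i), ← Finset.mul_prod_erase _ _ hji, mul_assoc]
  set z : κ → ι → κ := fun v => (Equiv.funSplitAt j κ).symm (v, w) with hz
  have hzj (v : κ) : z v j = v := by simp [hz]
  have hzne (v : κ) {k : ι} (hk : k ≠ j) : z v k = z v₀ k := by simp [hz, hk]
  have hrest (v : κ) : ∏ k ∈ (Finset.univ.erase i).erase j, A k (z v (π k)) (z v k) =
      ∏ k ∈ (Finset.univ.erase i).erase j, A k (z v₀ (π k)) (z v₀ k) := by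
    refine Finset.prod_congr rfl fun k hk => ?_
    simp only [Finset.mem_erase, Finset.mem_univ, and_true] at hk
    rw [hzne v hk.1, hzne v fun h => hk.2 (π.injective (h.trans hπ.symm))]
  have hrest' (v : κ) : ∏ k ∈ (Finset.univ.erase i).erase j,
      Function.update A i (A j * A i) k (z v ((π * Equiv.swap i j) k)) (z v k) =
      ∏ k ∈ (Finset.univ.erase i).erase j, A k (z v₀ (π k)) (z v₀ k) := by
    rw [← hrest v]
    refine Finset.prod_congr rfl fun k hk => ?_
    simp only [Finset.mem_erase, Finset.mem_univ, and_true] at hk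
    rw [Function.update_of_ne hk.2, Equiv.Perm.mul_apply,
      Equiv.swap_apply_of_ne_of_ne hk.2 hk.1]
  change ∑ v, ∏ k, A k (z v (π k)) (z v k) =
    ∑ v, ∏ k, Function.update A i (A j * A i) k (z v ((π * Equiv.swap i j) k)) (z v k)
  simp only [hsplit, hrest, hrest', ← Finset.sum_mul]
  congr 1
  simp only [hπ, Equiv.Perm.mul_apply, Equiv.swap_apply_left, Equiv.swap_apply_right,
    Function.update_self, Function.update_of_ne hij.symm, hzj, hzne _ hij, hzne _ hj]
  rw [← Finset.mul_sum, show ∑ v, A j v v = 1 from hA, mul_one, Matrix.mul_apply]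
  exact Finset.sum_congr rfl fun _ _ => mul_comm _ _

theorem trace_tensorMatrix_mul_swap {A : ι → Matrix κ κ ℂ} {a b : ι} (hab : a ≠ b)
    (hA : ∀ i ≠ a, (A i).trace = 1) :
    (tensorMatrix A * factorPerm κ (Equiv.swap a b)).trace = (A b * A a).trace := by
  rw [trace_tensorMatrix_mul_factorPerm_merge A _ hab (Equiv.swap_apply_left a b)
    (hA b hab.symm), Equiv.swap_mul_self, trace_tensorMatrix_mul_factorPerm_one,
    Fintype.prod_eq_single a]
  · rw [Function.update_self]
  · intro i hi
    rw [Function.update_of_ne hi, hA i hi]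

theorem trace_tensorMatrix_mul_swap_mul_swap_of_disjoint {A : ι → Matrix κ κ ℂ} {a b s t : ι}
    (hab : a ≠ b) (hst : s ≠ t) (has : a ≠ s) (hat : a ≠ t) (hbs : b ≠ s) (hbt : b ≠ t)
    (hA : ∀ i, (A i).trace = 1) :
    (tensorMatrix A * factorPerm κ (Equiv.swap a b * Equiv.swap s t)).trace =
      (A b * A a).trace * (A t * A s).trace := by
  rw [trace_tensorMatrix_mul_factorPerm_merge A _ hst
    (by simp [Equiv.swap_apply_of_ne_of_ne hat.symm hbt.symm]) (hA t),
    Equiv.mul_swap_mul_self,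
    trace_tensorMatrix_mul_factorPerm_merge _ _ hab (Equiv.swap_apply_left a b)
      (by rw [Function.update_of_ne hbs, hA]),
    Equiv.swap_mul_self, trace_tensorMatrix_mul_factorPerm_one, Fintype.prod_eq_mul a s has]
  · simp [Function.update_of_ne, has, has.symm, hbs]
  · rintro i ⟨hia, his⟩
    rw [Function.update_of_ne hia, Function.update_of_ne his, hA]

theorem trace_tensorMatrix_mul_swap_mul_swap {A : ι → Matrix κ κ ℂ} {a b t : ι}
    (hab : a ≠ b) (hat : a ≠ t) (hbt : b ≠ t) (hA : ∀ i, (A i).trace = 1) :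
    (tensorMatrix A * factorPerm κ (Equiv.swap a b * Equiv.swap a t)).trace =
      (A a * (A b * A t)).trace := by
  have h : Equiv.swap a b * Equiv.swap a t * Equiv.swap t b = Equiv.swap t a := by
    ext k
    simp only [Equiv.Perm.mul_apply, Equiv.swap_apply_def]
    split_ifs <;> simp_all
  rw [trace_tensorMatrix_mul_factorPerm_merge A _ hbt.symm (by simp) (hA b), h,
    trace_tensorMatrix_mul_swap hat.symm]
  · rw [Function.update_self, Function.update_of_ne hat]
  · intro i hi
    rw [Function.update_of_ne hi, hA]

end PermutationTraces

section PairState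

variable {m n d : ℕ} (ρ σ : Matrix (Fin d) (Fin d) ℂ)

theorem pairState_eq_submatrix :
    pairState m n d ρ σ =
      (tensorMatrix (Sum.elim (fun _ : Fin m => ρ) fun _ : Fin n => σ)).submatrix
        (Equiv.sumArrowEquivProdArrow (Fin m) (Fin n) (Fin d)).symm
        (Equiv.sumArrowEquivProdArrow (Fin m) (Fin n) (Fin d)).symm := by
  ext p q
  simp [pairState, tensorMatrix, Equiv.sumArrowEquivProdArrow]

theorem permOpLeft_swap_eq_submatrix (a b : Fin m) :
    permOpLeft m n d (Equiv.swap a b) =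
      (factorPerm (Fin d) (Equiv.swap (Sum.inl a : Fin m ⊕ Fin n) (Sum.inl b))).submatrix
        (Equiv.sumArrowEquivProdArrow (Fin m) (Fin n) (Fin d)).symm
        (Equiv.sumArrowEquivProdArrow (Fin m) (Fin n) (Fin d)).symm := by
  ext p q
  simp only [permOpLeft, factorPerm, Matrix.of_apply, Matrix.submatrix_apply]
  congr 1
  simp [funext_iff, Equiv.sumArrowEquivProdArrow, Sum.inl_injective.swap_apply,
    Equiv.swap_apply_of_ne_of_ne]

theorem swapOp_eq_submatrix (s : Fin m) (t : Fin n) :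
    swapOp m n d s t =
      (factorPerm (Fin d) (Equiv.swap (Sum.inl s) (Sum.inr t))).submatrix
        (Equiv.sumArrowEquivProdArrow (Fin m) (Fin n) (Fin d)).symm
        (Equiv.sumArrowEquivProdArrow (Fin m) (Fin n) (Fin d)).symm := by
  ext p q
  simp only [swapOp, factorPerm, Matrix.of_apply, Matrix.submatrix_apply]
  congr 1
  simp only [eq_iff_iff, funext_iff, Sum.forall, Function.comp_apply,
    Equiv.sumArrowEquivProdArrow, Equiv.coe_fn_symm_mk, Sum.elim_inl, Sum.elim_inr]
  constructor
  · rintro ⟨h₁, h₂, h₃, h₄⟩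
    refine ⟨fun i => ?_, fun j => ?_⟩
    · rcases eq_or_ne i s with rfl | hi
      · simpa
      · rw [Equiv.swap_apply_of_ne_of_ne (by simpa) (by simp)]
        exact h₁ i hi
    · rcases eq_or_ne j t with rfl | hj
      · simpa
      · rw [Equiv.swap_apply_of_ne_of_ne (by simp) (by simpa)]
        exact h₂ j hj
  · rintro ⟨h₁, h₂⟩
    refine ⟨fun i hi => ?_, fun j hj => ?_, ?_, ?_⟩
    · rw [h₁, Equiv.swap_apply_of_ne_of_ne (by simpa) (by simp), Sum.elim_inl]
    · rw [h₂, Equiv.swap_apply_of_ne_of_ne (by simp) (by simpa), Sum.elim_inr]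
    · simp [h₁]
    · simp [h₂]

variable {ρ σ}

theorem trace_pairState_mul_permOpLeft_swap {a b : Fin m} (hab : a ≠ b)
    (hρ : ρ.trace = 1) (hσ : σ.trace = 1) :
    (pairState m n d ρ σ * permOpLeft m n d (Equiv.swap a b)).trace = (ρ ^ 2).trace := by
  rw [pairState_eq_submatrix, permOpLeft_swap_eq_submatrix, Matrix.submatrix_mul_equiv,
    trace_submatrix_equiv, trace_tensorMatrix_mul_swap (by simpa) (by simp [hρ, hσ])]
  simp [pow_two]

theorem trace_pairState_mul_swapOp (s : Fin m) (t : Fin n)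
    (hρ : ρ.trace = 1) (hσ : σ.trace = 1) :
    (pairState m n d ρ σ * swapOp m n d s t).trace = (ρ * σ).trace := by
  rw [pairState_eq_submatrix, swapOp_eq_submatrix, Matrix.submatrix_mul_equiv,
    trace_submatrix_equiv, trace_tensorMatrix_mul_swap (by simp) (by simp [hρ, hσ])]
  simp [Matrix.trace_mul_comm σ]

theorem trace_pairState_mul_permOpLeft_swap_mul_swapOp {a b : Fin m} (hab : a ≠ b)
    (s : Fin m) (t : Fin n) (hρ : ρ.trace = 1) (hσ : σ.trace = 1) :
    (pairState m n d ρ σ * (permOpLeft m n d (Equiv.swap a b) * swapOp m n d s t)).trace =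
      if s = a ∨ s = b then (ρ ^ 2 * σ).trace else (ρ ^ 2).trace * (ρ * σ).trace := by
  have hA : ∀ i, (Sum.elim (fun _ : Fin m => ρ) (fun _ : Fin n => σ) i).trace = 1 := by
    simp [hρ, hσ]
  rw [pairState_eq_submatrix, permOpLeft_swap_eq_submatrix, swapOp_eq_submatrix,
    Matrix.submatrix_mul_equiv, Matrix.submatrix_mul_equiv, trace_submatrix_equiv,
    factorPerm_mul]
  split_ifs with h
  · rcases h with rfl | rfl
    · rw [trace_tensorMatrix_mul_swap_mul_swap (by simpa) (by simp) (by simp) hA]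
      simp [pow_two, mul_assoc]
    · rw [Equiv.swap_comm (Sum.inl a), trace_tensorMatrix_mul_swap_mul_swap
        (by simpa using hab.symm) (by simp) (by simp) hA]
      simp [pow_two, mul_assoc]
  · push Not at h
    rw [trace_tensorMatrix_mul_swap_mul_swap_of_disjoint (by simpa) (by simp)
      (by simpa using h.1.symm) (by simp) (by simpa using h.2.symm) (by simp) hA]
    simp [pow_two, Matrix.trace_mul_comm σ]

theorem mem_transpositions {τ : Equiv.Perm (Fin m)} : τ ∈ transpositions m ↔ τ.IsSwap := by
  simp [transpositions]

theorem card_transpositions_ne_zero (hm : 2 ≤ m) : ((transpositions m).card : ℂ) ≠ 0 := by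
  have : (Equiv.swap (⟨0, by omega⟩ : Fin m) ⟨1, by omega⟩) ∈ transpositions m :=
    mem_transpositions.2 ⟨_, _, by simp, rfl⟩
  exact_mod_cast Finset.card_ne_zero_of_mem this

theorem trace_pairState_mul_Oρρ (hm : 2 ≤ m) (hρ : ρ.trace = 1) (hσ : σ.trace = 1) :
    (pairState m n d ρ σ * Oρρ m n d).trace = (ρ ^ 2).trace := by
  have h : ∀ τ ∈ transpositions m,
      (pairState m n d ρ σ * permOpLeft m n d τ).trace = (ρ ^ 2).trace := by
    intro τ hτ
    obtain ⟨a, b, hab, rfl⟩ := mem_transpositions.1 hτ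
    exact trace_pairState_mul_permOpLeft_swap hab hρ hσ
  rw [Oρρ, Matrix.mul_smul, Matrix.trace_smul, Matrix.mul_sum, Matrix.trace_sum,
    Finset.sum_congr rfl h, Finset.sum_const, nsmul_eq_mul, smul_eq_mul,
    inv_mul_cancel_left₀ (card_transpositions_ne_zero hm)]

theorem trace_pairState_mul_Oρσ (hm : m ≠ 0) (hn : n ≠ 0)
    (hρ : ρ.trace = 1) (hσ : σ.trace = 1) :
    (pairState m n d ρ σ * Oρσ m n d).trace = (ρ * σ).trace := by
  have hm' : (m : ℂ) ≠ 0 := by exact_mod_cast hm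
  have hn' : (n : ℂ) ≠ 0 := by exact_mod_cast hn
  simp only [Oρσ, Matrix.mul_smul, Matrix.trace_smul, Matrix.mul_sum, Matrix.trace_sum,
    trace_pairState_mul_swapOp _ _ hρ hσ, Finset.sum_const, Finset.card_univ, Fintype.card_fin,
    nsmul_eq_mul, smul_eq_mul]
  field_simp

theorem sum_ite_eq_or_eq {a b : Fin m} (hab : a ≠ b) (x y : ℂ) :
    ∑ s, (if s = a ∨ s = b then x else y) = 2 * x + (m - 2) * y := by
  have h (s : Fin m) : (if s = a ∨ s = b then x else y) =
      (if s = a then x - y else 0) + (if s = b then x - y else 0) + y := by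
    by_cases ha : s = a
    · simp [ha, hab]
    · simp [ha]
      split_ifs <;> ring
  simp only [h, Finset.sum_add_distrib, Finset.sum_ite_eq', Finset.mem_univ, if_true,
    Finset.sum_const, Finset.card_univ, Fintype.card_fin, nsmul_eq_mul]
  ring

theorem trace_pairState_mul_Oρρ_mul_Oρσ (hm : 2 ≤ m) (hn : n ≠ 0)
    (hρ : ρ.trace = 1) (hσ : σ.trace = 1) :
    (pairState m n d ρ σ * (Oρρ m n d * Oρσ m n d)).trace =
      (2 * (ρ ^ 2 * σ).trace + (m - 2) * ((ρ ^ 2).trace * (ρ * σ).trace)) / m := by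
  have hm' : (m : ℂ) ≠ 0 := by exact_mod_cast (by omega : m ≠ 0)
  have hn' : (n : ℂ) ≠ 0 := by exact_mod_cast hn
  have h : ∀ τ ∈ transpositions m,
      (pairState m n d ρ σ * (permOpLeft m n d τ * Oρσ m n d)).trace =
        (2 * (ρ ^ 2 * σ).trace + (m - 2) * ((ρ ^ 2).trace * (ρ * σ).trace)) / m := by
    intro τ hτ
    obtain ⟨a, b, hab, rfl⟩ := mem_transpositions.1 hτ
    simp only [Oρσ, Matrix.mul_smul, Matrix.trace_smul, Matrix.mul_sum, Matrix.trace_sum,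
      trace_pairState_mul_permOpLeft_swap_mul_swapOp hab _ _ hρ hσ, Finset.sum_const,
      Finset.card_univ, Fintype.card_fin, nsmul_eq_mul, smul_eq_mul]
    rw [← Finset.mul_sum, sum_ite_eq_or_eq hab]
    field_simp
  rw [Oρρ, Matrix.smul_mul, Matrix.mul_smul, Matrix.trace_smul, Matrix.sum_mul, Matrix.mul_sum,
    Matrix.trace_sum, Finset.sum_congr rfl h, Finset.sum_const, nsmul_eq_mul, smul_eq_mul,
    inv_mul_cancel_left₀ (card_transpositions_ne_zero hm)]

end PairState

theorem stmt9 (m n d : ℕ) (hm : 2 ≤ m) (hn : 1 ≤ n)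
    (ρ σ : Matrix (Fin d) (Fin d) ℂ)
    (hρ : ρ.PosSemidef) (hρtr : ρ.trace = 1)
    (hσ : σ.PosSemidef) (hσtr : σ.trace = 1) :
    (pairState m n d ρ σ * (Oρρ m n d * Oρσ m n d)).trace -
        (pairState m n d ρ σ * Oρρ m n d).trace *
          (pairState m n d ρ σ * Oρσ m n d).trace =
      (2 / (m : ℂ)) * ((ρ ^ 2 * σ).trace - (ρ ^ 2).trace * (ρ * σ).trace) := by
  have hm' : (m : ℂ) ≠ 0 := by exact_mod_cast (by omega : m ≠ 0)
  rw [trace_pairState_mul_Oρρ_mul_Oρσ hm (by omega) hρtr hσtr,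
    trace_pairState_mul_Oρρ hm hρtr hσtr,
    trace_pairState_mul_Oρσ (by omega) (by omega) hρtr hσtr]
  field_simp
  ring
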